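/- arXiv:1304.5083 — 4 statements merged into one kernel-verified Lean document; each statement's English description precedes it below -/
import Mathlib

section
/- For all integers n ≥ 0, t_n = ((1+Sγ)/(1+Sγ²))·(1/γ)^n − ((Sγ−Sγ²)/(1+Sγ²))·(−Sγ)^n. -/
/-- Fix integers `L ≥ 1`, `S ≥ 0` with `L + S ≥ 2`, and let `γ ∈ (0,1)`
satisfy `Lγ + Sγ² = 1`.  With `t₀ = 1`, `t₁ = L + S`, `tₙ = L tₙ₋₁ + S tₙ₋₂`, for all `n ≥ 0`
we have `tₙ = ((1+Sγ)/(1+Sγ²))·(1/γ)ⁿ − ((Sγ−Sγ²)/(1+Sγ²))·(−Sγ)ⁿ`. -/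
theorem stmt_0 (L S : ℕ) (hL : 1 ≤ L) (hLS : 2 ≤ L + S)
    (γ : ℝ) (hγ0 : 0 < γ) (hγ1 : γ < 1)
    (hγeq : (L : ℝ) * γ + (S : ℝ) * γ ^ 2 = 1)
    (t : ℕ → ℕ) (ht0 : t 0 = 1) (ht1 : t 1 = L + S)
    (htrec : ∀ n : ℕ, t (n + 2) = L * t (n + 1) + S * t n) :
    ∀ n : ℕ, (t n : ℝ) =
      ((1 + (S : ℝ) * γ) / (1 + (S : ℝ) * γ ^ 2)) * (1 / γ) ^ n
        - (((S : ℝ) * γ - (S : ℝ) * γ ^ 2) / (1 + (S : ℝ) * γ ^ 2)) * (-((S : ℝ) * γ)) ^ n := by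
  have hγ : γ ≠ 0 := hγ0.ne'
  have hD : 1 + (S : ℝ) * γ ^ 2 ≠ 0 := by positivity
  have hLval : (L : ℝ) = 1 / γ - S * γ := by
    field_simp
    linarith
  intro n
  induction n using Nat.twoStepInduction with
  | zero =>
    rw [ht0]
    push_cast
    field_simp
    ring
  | one =>
    rw [ht1]
    push_cast
    rw [hLval]
    field_simp
    ring
  | more n ih₀ ih₁ =>
    have hroot : (1 / γ) ^ 2 = L * (1 / γ) + S := by
      rw [hLval]
      field_simp
      ring
    have hroot' : (-((S : ℝ) * γ)) ^ 2 = L * (-((S : ℝ) * γ)) + S := by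
      rw [hLval]
      field_simp
      ring
    rw [htrec]
    push_cast
    rw [ih₀, ih₁, pow_add _ n 2, pow_add _ n 2, hroot, hroot']
    ring
end

section
/- For every n ≥ 1, the number of admissible n-tuples of digits equals t_n; moreover, the number of admissible n-tuples with i_n ≤ L−1 equals l_n, and the number of admissible n-tuples with i_n ≥ L equals s_n. Equivalently, the number of n-tuples of digits containing at least one pair of consecutive entries (i_h, i_{h+1}) ∈ E_{L,S} equals (L+S)^n − t_n. -/
/-- No two consecutive entries of `i` form a pair in
`{L, …, L + S - 1} × {1, …, L + S - 1}`. -/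
abbrev IsAdmissible (L : ℕ) {d n : ℕ} (i : Fin n → Fin d) : Prop :=
  ∀ h h' : Fin n, (h' : ℕ) = (h : ℕ) + 1 → ¬(L ≤ (i h : ℕ) ∧ 1 ≤ (i h' : ℕ))

theorem isAdmissible_snoc (L : ℕ) {d n : ℕ} (p : Fin (n + 1) → Fin d) (x : Fin d) :
    IsAdmissible L (Fin.snoc p x : Fin (n + 2) → Fin d) ↔
      IsAdmissible L p ∧ ¬(L ≤ (p (Fin.last n) : ℕ) ∧ 1 ≤ (x : ℕ)) := by
  constructor
  · intro H
    refine ⟨fun h h' e => ?_, ?_⟩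
    · simpa only [Fin.snoc_castSucc] using H h.castSucc h'.castSucc (by simpa using e)
    · simpa only [Fin.snoc_castSucc, Fin.snoc_last] using
        H (Fin.last n).castSucc (Fin.last (n + 1)) (by simp)
  · rintro ⟨H, Hx⟩ h h' e
    induction h using Fin.lastCases with
    | last => have := h'.isLt; simp at e; omega
    | cast h =>
      induction h' using Fin.lastCases with
      | last =>
        obtain rfl : h = Fin.last n := by ext; simp at e ⊢; omega
        simpa only [Fin.snoc_castSucc, Fin.snoc_last] using Hx
      | cast h' =>
        simpa only [Fin.snoc_castSucc] using H h h' (by simpa using e)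

theorem card_filter_snoc {α : Type*} [Fintype α] {n : ℕ} (P : (Fin (n + 1) → α) → Prop)
    [DecidablePred P] :
    (Finset.univ.filter P).card =
      (Finset.univ.filter fun q : α × (Fin n → α) => P (Fin.snoc q.2 q.1)).card := by
  symm
  refine Finset.card_equiv (Fin.snocEquiv fun _ => α) fun q => ?_
  simp only [Finset.mem_filter, Finset.mem_univ, true_and]
  rfl

theorem card_fin_filter_lt (L S : ℕ) :
    (Finset.univ.filter fun x : Fin (L + S) => (x : ℕ) < L).card = L := by
  simp [Fin.card_filter_val_lt]

theorem card_fin_filter_le (L S : ℕ) :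
    (Finset.univ.filter fun x : Fin (L + S) => L ≤ (x : ℕ)).card = S := by
  have := Finset.card_filter_add_card_filter_not (s := Finset.univ)
    (fun x : Fin (L + S) => (x : ℕ) < L)
  simp only [not_lt, card_fin_filter_lt, Finset.card_univ, Fintype.card_fin] at this
  omega

theorem card_isAdmissible_last_lt_succ (L S n : ℕ) (hL : 1 ≤ L) :
    (Finset.univ.filter fun i : Fin (n + 2) → Fin (L + S) =>
        IsAdmissible L i ∧ (i (Fin.last (n + 1)) : ℕ) < L).card =
      L * (Finset.univ.filter fun i : Fin (n + 1) → Fin (L + S) =>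
        IsAdmissible L i ∧ (i (Fin.last n) : ℕ) < L).card +
      (Finset.univ.filter fun i : Fin (n + 1) → Fin (L + S) =>
        IsAdmissible L i ∧ L ≤ (i (Fin.last n) : ℕ)).card := by
  rw [card_filter_snoc]
  simp only [isAdmissible_snoc, Fin.snoc_last]
  have hd : 0 < L + S := by omega
  have key : (Finset.univ.filter fun q : Fin (L + S) × (Fin (n + 1) → Fin (L + S)) =>
      (IsAdmissible L q.2 ∧ ¬(L ≤ (q.2 (Fin.last n) : ℕ) ∧ 1 ≤ (q.1 : ℕ))) ∧ (q.1 : ℕ) < L) =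
      ((Finset.univ.filter fun x : Fin (L + S) => (x : ℕ) < L) ×ˢ
        (Finset.univ.filter fun i : Fin (n + 1) → Fin (L + S) =>
          IsAdmissible L i ∧ (i (Fin.last n) : ℕ) < L)) ∪
      (({⟨0, hd⟩} : Finset (Fin (L + S))) ×ˢ
        (Finset.univ.filter fun i : Fin (n + 1) → Fin (L + S) =>
          IsAdmissible L i ∧ L ≤ (i (Fin.last n) : ℕ))) := by
    ext ⟨x, p⟩
    simp only [Finset.mem_filter, Finset.mem_univ, true_and, Finset.mem_union,
      Finset.mem_product, Finset.mem_singleton, Fin.ext_iff]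
    generalize IsAdmissible L p = A
    by_cases hp : A
    · simp only [hp, true_and]
      omega
    · simp only [hp, false_and, and_false, or_false]
  rw [key, Finset.card_union_of_disjoint, Finset.card_product, Finset.card_product,
    card_fin_filter_lt, Finset.card_singleton, one_mul]
  refine Finset.disjoint_left.2 fun q h₁ h₂ => ?_
  simp only [Finset.mem_filter, Finset.mem_product] at h₁ h₂
  omega

theorem card_isAdmissible_le_last_succ (L S n : ℕ) (hL : 1 ≤ L) :
    (Finset.univ.filter fun i : Fin (n + 2) → Fin (L + S) =>
        IsAdmissible L i ∧ L ≤ (i (Fin.last (n + 1)) : ℕ)).card =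
      S * (Finset.univ.filter fun i : Fin (n + 1) → Fin (L + S) =>
        IsAdmissible L i ∧ (i (Fin.last n) : ℕ) < L).card := by
  rw [card_filter_snoc]
  simp only [isAdmissible_snoc, Fin.snoc_last]
  rw [← card_fin_filter_le L S, ← Finset.card_product, card_fin_filter_le]
  congr 1
  ext ⟨x, p⟩
  simp only [Finset.mem_filter, Finset.mem_univ, true_and, Finset.mem_product]
  generalize IsAdmissible L p = A
  by_cases hp : A
  · simp only [hp, true_and]
    omega
  · simp only [hp, false_and, and_false]

theorem card_isAdmissible_last (L S : ℕ) (hL : 1 ≤ L) (l s : ℕ → ℕ)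
    (hl0 : l 0 = 1) (hs0 : s 0 = 0)
    (hlrec : ∀ n : ℕ, l (n + 1) = L * l n + s n)
    (hsrec : ∀ n : ℕ, s (n + 1) = S * l n) (n : ℕ) :
    (Finset.univ.filter fun i : Fin (n + 1) → Fin (L + S) =>
        IsAdmissible L i ∧ (i (Fin.last n) : ℕ) < L).card = l (n + 1) ∧
      (Finset.univ.filter fun i : Fin (n + 1) → Fin (L + S) =>
        IsAdmissible L i ∧ L ≤ (i (Fin.last n) : ℕ)).card = s (n + 1) := by
  induction n with
  | zero =>
    simp only [hlrec, hsrec, hl0, hs0, mul_one, add_zero]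
    constructor
    · conv_rhs => rw [← card_fin_filter_lt L S]
      exact Finset.card_equiv (Equiv.funUnique (Fin 1) _) fun i => by simp
    · conv_rhs => rw [← card_fin_filter_le L S]
      exact Finset.card_equiv (Equiv.funUnique (Fin 1) _) fun i => by simp
  | succ n ih =>
    rw [card_isAdmissible_last_lt_succ L S n hL, card_isAdmissible_le_last_succ L S n hL,
      ih.1, ih.2, hlrec (n + 1), hsrec (n + 1)]
    exact ⟨rfl, rfl⟩

theorem eq_add_of_recurrence (L S : ℕ)
    (t l s : ℕ → ℕ) (ht0 : t 0 = 1) (ht1 : t 1 = L + S)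
    (htrec : ∀ n : ℕ, t (n + 2) = L * t (n + 1) + S * t n)
    (hl0 : l 0 = 1) (hs0 : s 0 = 0)
    (hlrec : ∀ n : ℕ, l (n + 1) = L * l n + s n)
    (hsrec : ∀ n : ℕ, s (n + 1) = S * l n) (n : ℕ) : t n = l n + s n := by
  induction n using Nat.twoStepInduction with
  | zero => simp [ht0, hl0, hs0]
  | one => simp [ht1, hlrec, hsrec, hl0, hs0]
  | more n h₀ h₁ =>
    rw [htrec, h₀, h₁]
    simp only [hlrec, hsrec]
    ring


/-- Fix `L ≥ 1`, `S ≥ 0` with `L + S ≥ 2`.  Digits are elements of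
`Fin (L+S)`; a tuple `(i₁,…,iₙ)` is admissible if no consecutive pair `(i_h, i_{h+1})`
lies in `E_{L,S} = {L,…,L+S−1} × {1,…,L+S−1}`.  For every `n ≥ 1` (here `n+1` with
`n : ℕ`): the number of admissible `n`-tuples is `tₙ`; those with last digit `≤ L−1`
number `lₙ`; those with last digit `≥ L` number `sₙ`; and the tuples containing at least
one forbidden pair number `(L+S)ⁿ − tₙ`. -/
theorem stmt_3 (L S : ℕ) (hL : 1 ≤ L) (hLS : 2 ≤ L + S)
    (t l s : ℕ → ℕ) (ht0 : t 0 = 1) (ht1 : t 1 = L + S)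
    (htrec : ∀ n : ℕ, t (n + 2) = L * t (n + 1) + S * t n)
    (hl0 : l 0 = 1) (hs0 : s 0 = 0)
    (hlrec : ∀ n : ℕ, l (n + 1) = L * l n + s n)
    (hsrec : ∀ n : ℕ, s (n + 1) = S * l n) :
    ∀ n : ℕ,
      (Finset.univ.filter fun i : Fin (n + 1) → Fin (L + S) =>
          ∀ h h' : Fin (n + 1), (h' : ℕ) = (h : ℕ) + 1 →
            ¬(L ≤ (i h : ℕ) ∧ 1 ≤ (i h' : ℕ))).card = t (n + 1) ∧
      (Finset.univ.filter fun i : Fin (n + 1) → Fin (L + S) =>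
          (∀ h h' : Fin (n + 1), (h' : ℕ) = (h : ℕ) + 1 →
            ¬(L ≤ (i h : ℕ) ∧ 1 ≤ (i h' : ℕ))) ∧ (i (Fin.last n) : ℕ) ≤ L - 1).card
        = l (n + 1) ∧
      (Finset.univ.filter fun i : Fin (n + 1) → Fin (L + S) =>
          (∀ h h' : Fin (n + 1), (h' : ℕ) = (h : ℕ) + 1 →
            ¬(L ≤ (i h : ℕ) ∧ 1 ≤ (i h' : ℕ))) ∧ L ≤ (i (Fin.last n) : ℕ)).card
        = s (n + 1) ∧
      (Finset.univ.filter fun i : Fin (n + 1) → Fin (L + S) =>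
          ∃ h h' : Fin (n + 1), (h' : ℕ) = (h : ℕ) + 1 ∧
            L ≤ (i h : ℕ) ∧ 1 ≤ (i h' : ℕ)).card
        = (L + S) ^ (n + 1) - t (n + 1) := by
  intro n
  obtain ⟨hl, hs⟩ := card_isAdmissible_last L S hL l s hl0 hs0 hlrec hsrec n
  have hlast (i : Fin (n + 1) → Fin (L + S)) :
      (i (Fin.last n) : ℕ) ≤ L - 1 ↔ (i (Fin.last n) : ℕ) < L := by omega
  have ht : (Finset.univ.filter fun i : Fin (n + 1) → Fin (L + S) =>
      IsAdmissible L i).card = t (n + 1) := by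
    rw [eq_add_of_recurrence L S t l s ht0 ht1 htrec hl0 hs0 hlrec hsrec, ← hl, ← hs,
      ← Finset.card_filter_add_card_filter_not (fun i => (i (Fin.last n) : ℕ) < L)]
    simp only [Finset.filter_filter, not_lt]
  refine ⟨ht, ?_, hs, ?_⟩
  · simp only [hlast]
    exact hl
  · have hcompl := Finset.card_filter_add_card_filter_not (s := Finset.univ)
      (fun i : Fin (n + 1) → Fin (L + S) => IsAdmissible L i)
    rw [ht, Finset.card_univ, Fintype.card_fun, Fintype.card_fin, Fintype.card_fin] at hcompl
    rw [← hcompl, Nat.add_sub_cancel_left]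
    congr 1
    ext i
    simp only [Finset.mem_filter, IsAdmissible]
    push Not
    rfl
end

section
/- The LS-radical inverse function φ_{L,S} is injective on ℕ_{L,S}: if m, n ∈ ℕ_{L,S} and φ_{L,S}(m) = φ_{L,S}(n), then m = n. -/
/-- The coefficient `b(i)`: `b(i) = i` if `i ≤ L−1` and `b(i) = L + (i−L)γ` if `i ≥ L`. -/
noncomputable def bcoef (L : ℕ) (γ : ℝ) (i : ℕ) : ℝ :=
  if i < L then (i : ℝ) else (L : ℝ) + ((i : ℝ) - (L : ℝ)) * γ

/-- The LS-radical inverse function `φ_{L,S}(n) = Σ_k b(a_k(n)) γ^{k+1}`, where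
`a_0(n), a_1(n), …` are the digits of `n` in base `L + S`. -/
noncomputable def phiLS (L S : ℕ) (γ : ℝ) (n : ℕ) : ℝ :=
  ∑ k ∈ Finset.range (Nat.digits (L + S) n).length,
    bcoef L γ ((Nat.digits (L + S) n).getD k 0) * γ ^ (k + 1)

/-- The value of a digit string `a₀, a₁, …`, namely `Σ_k b(a_k) γ^{k+1}`, in Horner form. -/
noncomputable def digitValue (L : ℕ) (γ : ℝ) (l : List ℕ) : ℝ :=
  l.foldr (fun a x => γ * (bcoef L γ a + x)) 0

theorem digitValue_nil (L : ℕ) (γ : ℝ) : digitValue L γ [] = 0 := rfl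

theorem digitValue_cons (L : ℕ) (γ : ℝ) (a : ℕ) (l : List ℕ) :
    digitValue L γ (a :: l) = γ * (bcoef L γ a + digitValue L γ l) := rfl

theorem sum_bcoef_eq_digitValue (L : ℕ) (γ : ℝ) (l : List ℕ) :
    ∑ k ∈ Finset.range l.length, bcoef L γ (l.getD k 0) * γ ^ (k + 1) = digitValue L γ l := by
  induction l with
  | nil => simp [digitValue_nil]
  | cons a l ih =>
    rw [digitValue_cons, ← ih, List.length_cons, Finset.sum_range_succ', mul_add, Finset.mul_sum,
      add_comm]
    congr 1
    · simp [mul_comm]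
    · refine Finset.sum_congr rfl fun k _ => ?_
      rw [List.getD_cons_succ]
      ring

theorem bcoef_succ (L : ℕ) (γ : ℝ) (a : ℕ) :
    bcoef L γ (a + 1) = bcoef L γ a + if a < L then 1 else γ := by
  unfold bcoef
  rcases lt_trichotomy (a + 1) L with h | h | h
  · rw [if_pos h, if_pos (by omega), if_pos (by omega)]
    push_cast
    ring
  · subst h
    simp
  · rw [if_neg (by omega), if_neg (by omega), if_neg (by omega)]
    push_cast
    ring

theorem bcoef_strictMono (L : ℕ) {γ : ℝ} (hγ : 0 < γ) : StrictMono (bcoef L γ) := by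
  refine strictMono_nat_of_lt_succ fun a => ?_
  rw [bcoef_succ]
  split_ifs <;> linarith

theorem bcoef_zero {L : ℕ} (hL : 1 ≤ L) (γ : ℝ) : bcoef L γ 0 = 0 := by
  simp [bcoef, Nat.pos_iff_ne_zero.mp hL]

theorem bcoef_nonneg {L : ℕ} (hL : 1 ≤ L) {γ : ℝ} (hγ : 0 < γ) (a : ℕ) : 0 ≤ bcoef L γ a :=
  (bcoef_zero hL γ).ge.trans ((bcoef_strictMono L hγ).monotone a.zero_le)

theorem digitValue_nonneg {L : ℕ} (hL : 1 ≤ L) {γ : ℝ} (hγ : 0 < γ) (l : List ℕ) :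
    0 ≤ digitValue L γ l := by
  induction l with
  | nil => exact le_rfl
  | cons a l ih =>
    rw [digitValue_cons]
    exact mul_nonneg hγ.le (add_nonneg (bcoef_nonneg hL hγ a) ih)

theorem digitValue_eq_zero_of_cons {L : ℕ} (hL : 1 ≤ L) {γ : ℝ} (hγ : 0 < γ) {a : ℕ} {l : List ℕ}
    (h : digitValue L γ (a :: l) = 0) : a = 0 ∧ digitValue L γ l = 0 := by
  rw [digitValue_cons, mul_eq_zero_iff_left hγ.ne',
    add_eq_zero_iff_of_nonneg (bcoef_nonneg hL hγ a) (digitValue_nonneg hL hγ l)] at h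
  exact ⟨(bcoef_strictMono L hγ).injective (h.1.trans (bcoef_zero hL γ).symm), h.2⟩

theorem ofDigits_eq_zero_of_digitValue_eq_zero {L : ℕ} (hL : 1 ≤ L) {γ : ℝ} (hγ : 0 < γ) (N : ℕ)
    {l : List ℕ} (h : digitValue L γ l = 0) : Nat.ofDigits N l = 0 := by
  induction l with
  | nil => rfl
  | cons a l ih =>
    obtain ⟨rfl, hl⟩ := digitValue_eq_zero_of_cons hL hγ h
    simp [Nat.ofDigits_cons, ih hl]

/-- The digit strings with entries below `L + S` in which a digit `≥ L` is only followed by `0`. -/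
def Admissible (L S : ℕ) (l : List ℕ) : Prop :=
  l.IsChain (fun a b => ¬(L ≤ a ∧ 1 ≤ b)) ∧ ∀ a ∈ l, a < L + S

theorem Admissible.tail {L S a : ℕ} {l : List ℕ} (h : Admissible L S (a :: l)) :
    Admissible L S l :=
  ⟨h.1.tail, fun b hb => h.2 b (List.mem_cons_of_mem a hb)⟩

/-- An admissible tail is too small to carry into the next value of the leading digit. -/
theorem bcoef_add_digitValue_lt_of_lt_one {L S : ℕ} (hL : 1 ≤ L) {γ : ℝ} (hγ : 0 < γ)
    {a : ℕ} {l : List ℕ} (h : Admissible L S (a :: l)) (hl : digitValue L γ l < 1)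
    (hl' : digitValue L γ l.tail < 1) :
    bcoef L γ a + digitValue L γ l < bcoef L γ (a + 1) := by
  rw [bcoef_succ]
  split_ifs with ha
  · linarith
  · cases l with
    | nil => simpa [digitValue_nil] using hγ
    | cons b l =>
      have hb : b = 0 := by
        have := (List.isChain_cons_cons.mp h.1).1
        omega
      subst hb
      rw [digitValue_cons, bcoef_zero hL, zero_add]
      rw [List.tail_cons] at hl'
      nlinarith

theorem digitValue_lt_one {L S : ℕ} (hL : 1 ≤ L) {γ : ℝ} (hγ : 0 < γ)
    (hγeq : (L : ℝ) * γ + (S : ℝ) * γ ^ 2 = 1) {l : List ℕ} (h : Admissible L S l) :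
    digitValue L γ l < 1 ∧ digitValue L γ l.tail < 1 := by
  induction l with
  | nil => simp [digitValue_nil]
  | cons a l ih =>
    obtain ⟨hl, hl'⟩ := ih h.tail
    refine ⟨?_, hl⟩
    have hlt := bcoef_add_digitValue_lt_of_lt_one hL hγ h hl hl'
    have hle : bcoef L γ (a + 1) ≤ bcoef L γ (L + S) :=
      (bcoef_strictMono L hγ).monotone (h.2 a List.mem_cons_self)
    have htop : γ * bcoef L γ (L + S) = 1 := by
      rw [bcoef, if_neg (by omega), ← hγeq]
      push_cast
      ring
    rw [digitValue_cons, ← htop]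
    exact mul_lt_mul_of_pos_left (hlt.trans_le hle) hγ

theorem digitValue_lt_of_head_lt {L S : ℕ} (hL : 1 ≤ L) {γ : ℝ} (hγ : 0 < γ)
    (hγeq : (L : ℝ) * γ + (S : ℝ) * γ ^ 2 = 1) {a b : ℕ} {l k : List ℕ}
    (h : Admissible L S (a :: l)) (hab : a < b) :
    digitValue L γ (a :: l) < digitValue L γ (b :: k) := by
  obtain ⟨hl, hl'⟩ := digitValue_lt_one hL hγ hγeq h.tail
  have hlt := bcoef_add_digitValue_lt_of_lt_one hL hγ h hl hl'
  have hle := (bcoef_strictMono L hγ).monotone (Nat.succ_le_of_lt hab)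
  rw [digitValue_cons, digitValue_cons]
  refine mul_lt_mul_of_pos_left ?_ hγ
  linarith [digitValue_nonneg hL hγ k]

theorem ofDigits_eq_of_digitValue_eq {L S : ℕ} (hL : 1 ≤ L) {γ : ℝ} (hγ : 0 < γ)
    (hγeq : (L : ℝ) * γ + (S : ℝ) * γ ^ 2 = 1) (N : ℕ) {l k : List ℕ}
    (hl : Admissible L S l) (hk : Admissible L S k) (h : digitValue L γ l = digitValue L γ k) :
    Nat.ofDigits N l = Nat.ofDigits N k := by
  induction l generalizing k with
  | nil => exact (ofDigits_eq_zero_of_digitValue_eq_zero hL hγ N h.symm).symm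
  | cons a l ih =>
    cases k with
    | nil => exact ofDigits_eq_zero_of_digitValue_eq_zero hL hγ N h
    | cons b k =>
      rcases lt_trichotomy a b with hab | rfl | hab
      · exact absurd h (digitValue_lt_of_head_lt hL hγ hγeq hl hab).ne
      · rw [digitValue_cons, digitValue_cons, mul_right_inj' hγ.ne', add_right_inj] at h
        rw [Nat.ofDigits_cons, Nat.ofDigits_cons, ih hl.tail hk.tail h]
      · exact absurd h (digitValue_lt_of_head_lt hL hγ hγeq hk hab).ne'

/-- The LS-radical inverse function is injective on `ℕ_{L,S}`:
if `m, n ∈ ℕ_{L,S}` and `φ_{L,S}(m) = φ_{L,S}(n)`, then `m = n`. -/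
theorem stmt_6 (L S : ℕ) (hL : 1 ≤ L) (hLS : 2 ≤ L + S)
    (γ : ℝ) (hγ0 : 0 < γ) (hγ1 : γ < 1)
    (hγeq : (L : ℝ) * γ + (S : ℝ) * γ ^ 2 = 1)
    (m n : ℕ)
    (hm : (Nat.digits (L + S) m).Chain' fun a b => ¬(L ≤ a ∧ 1 ≤ b))
    (hn : (Nat.digits (L + S) n).Chain' fun a b => ¬(L ≤ a ∧ 1 ≤ b))
    (heq : phiLS L S γ m = phiLS L S γ n) :
    m = n := by
  rw [phiLS, phiLS, sum_bcoef_eq_digitValue, sum_bcoef_eq_digitValue] at heq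
  rw [← Nat.ofDigits_digits (L + S) m, ← Nat.ofDigits_digits (L + S) n]
  exact ofDigits_eq_of_digitValue_eq hL hγ0 hγeq (L + S)
    ⟨hm, fun _ => Nat.digits_lt_base hLS⟩ ⟨hn, fun _ => Nat.digits_lt_base hLS⟩ heq
end

section
/- If S = L+1, then there exist constants c, c' > 0 such that for every n ≥ 1, c' · log t_n ≤ t_n · D(Λ^n_{L,S}) ≤ c · log t_n, where Λ^n_{L,S} is the set of the t_n left endpoints of the n-th LS-partition. -/
/-- The set `Λⁿ_{L,S}` of left endpoints `Σ_{k=1}^n b(i_k)γᵏ` of the `n`-th LS-partition,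
indexed by the admissible `n`-tuples of digits. -/
noncomputable def lamSet (L S : ℕ) (γ : ℝ) (n : ℕ) : Set ℝ :=
  {x : ℝ | ∃ i : Fin n → Fin (L + S),
    (∀ h h' : Fin n, (h' : ℕ) = (h : ℕ) + 1 → ¬(L ≤ (i h : ℕ) ∧ 1 ≤ (i h' : ℕ))) ∧
    x = ∑ k : Fin n, bcoef L γ (i k : ℕ) * γ ^ ((k : ℕ) + 1)}

/-- The discrepancy of a finite set `Q ⊂ [0,1)` of `t` points:
`D(Q) = sup_{0 ≤ a < b ≤ 1} | (1/t)·#{y ∈ Q : y ∈ [a,b)} − (b−a) |`. -/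
noncomputable def discSet (Q : Set ℝ) : ℝ :=
  sSup {d : ℝ | ∃ a b : ℝ, 0 ≤ a ∧ a < b ∧ b ≤ 1 ∧
    d = |((Q ∩ Set.Ico a b).ncard : ℝ) / (Q.ncard : ℝ) - (b - a)|}

/-- The endpoints of the LS-partitions for `S = L + 1`, generated through self-similarity; the
index is shifted by one, so that `lsPts L γ (n + 1)` is `lamSet L (L + 1) γ n`. -/
noncomputable def lsPts (L : ℕ) (γ : ℝ) : ℕ → Set ℝ
  | 0 => {0}
  | 1 => {0}
  | n + 2 => (⋃ i ∈ Finset.range L, (fun y : ℝ => (i + y) * γ) '' lsPts L γ (n + 1)) ∪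
      ⋃ i ∈ Finset.range (L + 1), (fun y : ℝ => (L + (i + y) * γ) * γ) '' lsPts L γ n

lemma mem_lsPts_add_two {L : ℕ} {γ : ℝ} {n : ℕ} {x : ℝ} :
    x ∈ lsPts L γ (n + 2) ↔ (∃ i < L, ∃ y ∈ lsPts L γ (n + 1), (i + y) * γ = x) ∨
      ∃ i < L + 1, ∃ y ∈ lsPts L γ n, (L + (i + y) * γ) * γ = x := by
  simp [lsPts]

lemma lsPts_finite (L : ℕ) (γ : ℝ) (n : ℕ) : (lsPts L γ n).Finite := by
  induction n using Nat.twoStepInduction with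
  | zero => simp [lsPts]
  | one => simp [lsPts]
  | more n ih0 ih1 =>
    exact ((Finset.range L).finite_toSet.biUnion fun i _ => ih1.image _).union
      ((Finset.range (L + 1)).finite_toSet.biUnion fun i _ => ih0.image _)

lemma lsPts_subset_Ico {L : ℕ} {γ : ℝ} (hγ : 0 < γ) (h1 : (L + 1) * γ = 1) (n : ℕ) :
    lsPts L γ n ⊆ Set.Ico 0 1 := by
  induction n using Nat.twoStepInduction with
  | zero => simp [lsPts]
  | one => simp [lsPts]
  | more n ih0 ih1 =>
    intro x hx
    rcases mem_lsPts_add_two.1 hx with ⟨i, hi, y, hy, rfl⟩ | ⟨i, hi, y, hy, rfl⟩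
    · obtain ⟨hy0, hy1⟩ := ih1 hy
      have hi' : (i : ℝ) + 1 ≤ L := by exact_mod_cast hi
      exact ⟨by positivity, by nlinarith⟩
    · obtain ⟨hy0, hy1⟩ := ih0 hy
      have hi' : (i : ℝ) ≤ L := by exact_mod_cast Nat.lt_succ_iff.1 hi
      have : (i + y) * γ < 1 := by nlinarith
      exact ⟨by positivity, by nlinarith⟩

lemma Nat.eq_of_cast_add_mem_Ico {i j : ℕ} {y : ℝ} (hy : y ∈ Set.Ico (0 : ℝ) 1)
    (h : (j : ℝ) + y ∈ Set.Ico (i : ℝ) (i + 1)) : j = i := by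
  obtain ⟨hy0, hy1⟩ := hy
  obtain ⟨h0, h1⟩ := h
  have a : (j : ℝ) < i + 1 := by linarith
  have b : (i : ℝ) < j + 1 := by linarith
  norm_cast at a b
  omega

lemma lsPts_inter_long {L : ℕ} {γ : ℝ} (hγ : 0 < γ) (h1 : (L + 1) * γ = 1) (n : ℕ) {i : ℕ}
    (hi : i < L) :
    lsPts L γ (n + 2) ∩ Set.Ico (i * γ) (i * γ + γ) =
      (fun y => i * γ + γ * y) '' lsPts L γ (n + 1) := by
  have hi' : (i : ℝ) + 1 ≤ L := by exact_mod_cast hi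
  ext x
  constructor
  · rintro ⟨hx, hx0, hx1⟩
    rcases mem_lsPts_add_two.1 hx with ⟨j, hj, y, hy, rfl⟩ | ⟨j, hj, y, hy, rfl⟩
    · have hji : j = i := by
        refine Nat.eq_of_cast_add_mem_Ico (lsPts_subset_Ico hγ h1 _ hy) ⟨?_, ?_⟩
        · exact le_of_mul_le_mul_right hx0 hγ
        · exact lt_of_mul_lt_mul_right (by linarith) hγ.le
      subst hji
      exact ⟨y, hy, by ring⟩
    · exfalso
      have hy0 := (lsPts_subset_Ico hγ h1 _ hy).1
      have : 0 ≤ (j + y) * γ * γ := by positivity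
      nlinarith
  · rintro ⟨y, hy, rfl⟩
    obtain ⟨hy0, hy1⟩ := lsPts_subset_Ico hγ h1 _ hy
    refine ⟨mem_lsPts_add_two.2 (Or.inl ⟨i, hi, y, hy, by ring⟩), ?_, ?_⟩
    · nlinarith
    · nlinarith

lemma lsPts_inter_short {L : ℕ} {γ : ℝ} (hγ : 0 < γ) (h1 : (L + 1) * γ = 1) (n : ℕ) {i : ℕ}
    (hi : i < L + 1) :
    lsPts L γ (n + 2) ∩ Set.Ico ((L + i * γ) * γ) ((L + i * γ) * γ + γ ^ 2) =
      (fun y => (L + i * γ) * γ + γ ^ 2 * y) '' lsPts L γ n := by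
  have hγ2 : 0 < γ ^ 2 := by positivity
  ext x
  constructor
  · rintro ⟨hx, hx0, hx1⟩
    rcases mem_lsPts_add_two.1 hx with ⟨j, hj, y, hy, rfl⟩ | ⟨j, hj, y, hy, rfl⟩
    · exfalso
      have hy1 := (lsPts_subset_Ico hγ h1 _ hy).2
      have hj' : (j : ℝ) + 1 ≤ L := by exact_mod_cast hj
      have : 0 ≤ i * γ * γ := by positivity
      nlinarith
    · have hji : j = i := by
        refine Nat.eq_of_cast_add_mem_Ico (lsPts_subset_Ico hγ h1 _ hy) ⟨?_, ?_⟩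
        · exact le_of_mul_le_mul_right (by linarith) hγ2
        · exact lt_of_mul_lt_mul_right (by linarith) hγ2.le
      subst hji
      exact ⟨y, hy, by ring⟩
  · rintro ⟨y, hy, rfl⟩
    obtain ⟨hy0, hy1⟩ := lsPts_subset_Ico hγ h1 _ hy
    refine ⟨mem_lsPts_add_two.2 (Or.inr ⟨i, hi, y, hy, by ring⟩), ?_, ?_⟩
    · nlinarith
    · nlinarith

lemma ncard_inter_Ico_add {A : Set ℝ} (hA : A.Finite) {a b : ℝ} (ha : 0 ≤ a) (hab : a ≤ b) :
    (A ∩ Set.Ico 0 b).ncard = (A ∩ Set.Ico 0 a).ncard + (A ∩ Set.Ico a b).ncard := by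
  rw [← Set.ncard_union_eq _ (hA.inter_of_left _) (hA.inter_of_left _),
    ← Set.inter_union_distrib_left, Set.Ico_union_Ico_eq_Ico ha hab]
  exact (Set.Ico_disjoint_Ico_same (a := 0)).mono Set.inter_subset_right Set.inter_subset_right

/-- Counting points in an initial interval ending in a cell on which `A` is a rescaled copy
of `M`. -/
lemma ncard_inter_cell {A M : Set ℝ} (hA : A.Finite) (hM : M ⊆ Set.Ico 0 1) {a h : ℝ} (ha : 0 ≤ a)
    (hh : 0 < h) (hcell : A ∩ Set.Ico a (a + h) = (fun y => a + h * y) '' M) {y : ℝ} (hy0 : 0 ≤ y)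
    (hy1 : y ≤ 1) :
    (A ∩ Set.Ico 0 (a + h * y)).ncard = (A ∩ Set.Ico 0 a).ncard + (M ∩ Set.Ico 0 y).ncard := by
  have hle : a ≤ a + h * y := by nlinarith
  have himage : A ∩ Set.Ico a (a + h * y) = (fun y => a + h * y) '' (M ∩ Set.Ico 0 y) := by
    ext x
    constructor
    · rintro ⟨hx, hx0, hx1⟩
      have hmem : x ∈ A ∩ Set.Ico a (a + h) := ⟨hx, hx0, by nlinarith⟩
      rw [hcell] at hmem
      obtain ⟨z, hz, rfl⟩ := hmem
      exact ⟨z, ⟨hz, (hM hz).1, lt_of_mul_lt_mul_left (by simpa using hx1) hh.le⟩, rfl⟩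
    · rintro ⟨z, ⟨hz, hz0, hz1⟩, rfl⟩
      have hmem : a + h * z ∈ A ∩ Set.Ico a (a + h) := hcell ▸ ⟨z, hz, rfl⟩
      exact ⟨hmem.1, hmem.2.1, by simpa using mul_lt_mul_of_pos_left hz1 hh⟩
  rw [ncard_inter_Ico_add hA ha hle, himage, Set.ncard_image_of_injective]
  intro u v huv
  exact mul_left_cancel₀ hh.ne' (add_left_cancel huv)

/-- The number of points of `lsPts L γ n` in `[0, x)`. -/
noncomputable def lsCount (L : ℕ) (γ : ℝ) (n : ℕ) (x : ℝ) : ℝ :=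
  ((lsPts L γ n ∩ Set.Ico 0 x).ncard : ℝ)

lemma lsCount_zero_right (L : ℕ) (γ : ℝ) (n : ℕ) : lsCount L γ n 0 = 0 := by
  simp [lsCount]

section Count

variable {L : ℕ} {γ : ℝ}

lemma lsCount_long_left (hγ : 0 < γ) (h1 : (L + 1) * γ = 1) (n : ℕ) {i : ℕ} (hi : i ≤ L) :
    lsCount L γ (n + 2) (i * γ) = i * lsCount L γ (n + 1) 1 := by
  induction i with
  | zero => simp [lsCount]
  | succ i ih =>
    have h := ncard_inter_cell (lsPts_finite L γ _) (lsPts_subset_Ico hγ h1 _) (by positivity) hγ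
      (lsPts_inter_long hγ h1 n hi) zero_le_one le_rfl
    have ih := ih (by omega)
    unfold lsCount at ih ⊢
    rw [show ((i + 1 : ℕ) : ℝ) * γ = i * γ + γ * 1 by push_cast; ring, h]
    push_cast
    rw [ih]
    ring

lemma lsCount_long (hγ : 0 < γ) (h1 : (L + 1) * γ = 1) (n : ℕ) {i : ℕ} (hi : i < L) {y : ℝ}
    (hy0 : 0 ≤ y) (hy1 : y ≤ 1) :
    lsCount L γ (n + 2) ((i + y) * γ) = i * lsCount L γ (n + 1) 1 + lsCount L γ (n + 1) y := by
  have h := ncard_inter_cell (lsPts_finite L γ _) (lsPts_subset_Ico hγ h1 _) (by positivity) hγ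
    (lsPts_inter_long hγ h1 n hi) hy0 hy1
  rw [← lsCount_long_left hγ h1 n hi.le]
  unfold lsCount
  rw [show (i + y) * γ = i * γ + γ * y by ring, h, Nat.cast_add]

lemma lsCount_short_left (hγ : 0 < γ) (h1 : (L + 1) * γ = 1) (n : ℕ) {i : ℕ} (hi : i ≤ L + 1) :
    lsCount L γ (n + 2) ((L + i * γ) * γ) =
      L * lsCount L γ (n + 1) 1 + i * lsCount L γ n 1 := by
  induction i with
  | zero => simpa using lsCount_long_left hγ h1 n le_rfl
  | succ i ih =>
    have h := ncard_inter_cell (lsPts_finite L γ _) (lsPts_subset_Ico hγ h1 _) (by positivity)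
      (by positivity) (lsPts_inter_short hγ h1 n hi) zero_le_one le_rfl
    have ih := ih (by omega)
    unfold lsCount at ih ⊢
    rw [show (L + ((i + 1 : ℕ) : ℝ) * γ) * γ = (L + i * γ) * γ + γ ^ 2 * 1 by push_cast; ring, h]
    push_cast
    rw [ih]
    ring

lemma lsCount_short (hγ : 0 < γ) (h1 : (L + 1) * γ = 1) (n : ℕ) {i : ℕ} (hi : i < L + 1) {y : ℝ}
    (hy0 : 0 ≤ y) (hy1 : y ≤ 1) :
    lsCount L γ (n + 2) ((L + (i + y) * γ) * γ) =
      L * lsCount L γ (n + 1) 1 + i * lsCount L γ n 1 + lsCount L γ n y := by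
  have h := ncard_inter_cell (lsPts_finite L γ _) (lsPts_subset_Ico hγ h1 _) (by positivity)
    (by positivity) (lsPts_inter_short hγ h1 n hi) hy0 hy1
  rw [← lsCount_short_left hγ h1 n hi.le]
  unfold lsCount
  rw [show (L + (i + y) * γ) * γ = (L + i * γ) * γ + γ ^ 2 * y by ring, h, Nat.cast_add]

lemma lsCount_one_add_two (hγ : 0 < γ) (h1 : (L + 1) * γ = 1) (n : ℕ) :
    lsCount L γ (n + 2) 1 = L * lsCount L γ (n + 1) 1 + (L + 1) * lsCount L γ n 1 := by
  have h := lsCount_short_left hγ h1 n le_rfl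
  push_cast at h
  rwa [h1, h1] at h

lemma lsCount_of_lt_two {n : ℕ} (hn : n < 2) {x : ℝ} (hx : 0 < x) : lsCount L γ n x = 1 := by
  have h : lsPts L γ n = {0} := by interval_cases n <;> rfl
  simp [lsCount, h, hx]

lemma lsCount_one_sub (hγ : 0 < γ) (h1 : (L + 1) * γ = 1) (n : ℕ) :
    (L + 1) * lsCount L γ n 1 - lsCount L γ (n + 1) 1 = (-1) ^ n * L := by
  induction n with
  | zero => simp [lsCount_of_lt_two]
  | succ n ih =>
    rw [lsCount_one_add_two hγ h1, pow_succ]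
    linarith

/-- The local discrepancy of `lsPts L γ n` on `[0, x)`, multiplied by the number of points. -/
noncomputable def lsError (L : ℕ) (γ : ℝ) (n : ℕ) (x : ℝ) : ℝ :=
  lsCount L γ n x - lsCount L γ n 1 * x

lemma lsError_long (hγ : 0 < γ) (h1 : (L + 1) * γ = 1) (n : ℕ) {i : ℕ} (hi : i < L) {y : ℝ}
    (hy0 : 0 ≤ y) (hy1 : y ≤ 1) :
    lsError L γ (n + 2) ((i + y) * γ) =
      lsError L γ (n + 1) y - (-1) ^ n * L * ((i + y) * γ) := by
  have h := lsCount_one_sub hγ h1 (n + 1)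
  rw [pow_succ] at h
  unfold lsError
  rw [lsCount_long hγ h1 n hi hy0 hy1]
  linear_combination (i + y) * γ * h - lsCount L γ (n + 1) 1 * (i + y) * h1

lemma lsError_short (hγ : 0 < γ) (h1 : (L + 1) * γ = 1) (n : ℕ) {i : ℕ} (hi : i < L + 1) {y : ℝ}
    (hy0 : 0 ≤ y) (hy1 : y ≤ 1) :
    lsError L γ (n + 2) ((L + (i + y) * γ) * γ) =
      lsError L γ n y - (-1) ^ n * L * (L * (1 - (L + (i + y) * γ) * γ)) := by
  have h := lsCount_one_sub hγ h1 n
  have h2 := lsCount_one_add_two hγ h1 n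
  have hL : (L : ℝ) = γ⁻¹ - 1 := by field_simp; linarith
  have hT : lsCount L γ (n + 1) 1 = (L + 1) * lsCount L γ n 1 - (-1) ^ n * L := by linarith
  unfold lsError
  rw [lsCount_short hγ h1 n hi hy0 hy1, h2, hT, hL]
  field_simp
  ring

/-- Every point of `[0, 1]` lies in a long or a short cell. -/
lemma exists_cell (h1 : (L + 1) * γ = 1) {x : ℝ} (hx0 : 0 ≤ x) (hx1 : x ≤ 1) :
    ∃ y : ℝ, 0 ≤ y ∧ y ≤ 1 ∧
      ((∃ i < L, x = (i + y) * γ) ∨ ∃ i < L + 1, x = (L + (i + y) * γ) * γ) := by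
  have key : ∀ (N : ℕ) (z : ℝ), 0 ≤ z → z ≤ N + 1 →
      ∃ i < N + 1, ∃ y : ℝ, 0 ≤ y ∧ y ≤ 1 ∧ z = i + y := by
    intro N z hz0 hz1
    rcases hz1.eq_or_lt with h | h
    · exact ⟨N, by omega, 1, by norm_num, le_rfl, h⟩
    · refine ⟨⌊z⌋₊, (Nat.floor_lt hz0).2 (by exact_mod_cast h), z - ⌊z⌋₊, ?_, ?_, by ring⟩
      · linarith [Nat.floor_le hz0]
      · linarith [Nat.lt_floor_add_one z]
  have hz1 : x * (L + 1) ≤ L + 1 := by nlinarith [(Nat.cast_nonneg L : (0 : ℝ) ≤ L)]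
  obtain ⟨i, hi, y, hy0, hy1, hxy⟩ := key L (x * (L + 1)) (by positivity) hz1
  have hx : x = (i + y) * γ := by linear_combination γ * hxy - x * h1
  rcases Nat.lt_succ_iff_lt_or_eq.1 hi with hi | rfl
  · exact ⟨y, hy0, hy1, Or.inl ⟨i, hi, hx⟩⟩
  · have hy2 : y * (i + 1) ≤ i + 1 := by nlinarith [(Nat.cast_nonneg i : (0 : ℝ) ≤ i)]
    obtain ⟨j, hj, z, hz0, hz1, hyz⟩ := key i (y * (i + 1)) (by positivity) hy2
    refine ⟨z, hz0, hz1, Or.inr ⟨j, hj, ?_⟩⟩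
    rw [hx]
    linear_combination γ ^ 2 * hyz - γ * y * h1

lemma abs_lsError_le (hγ : 0 < γ) (h1 : (L + 1) * γ = 1) (n : ℕ) {x : ℝ} (hx0 : 0 ≤ x)
    (hx1 : x ≤ 1) : |lsError L γ n x| ≤ 1 + L * n := by
  have hL : (0 : ℝ) ≤ L := Nat.cast_nonneg L
  have base : ∀ n < 2, ∀ x : ℝ, 0 ≤ x → x ≤ 1 → |lsError L γ n x| ≤ 1 := by
    intro n hn x hx0 hx1
    unfold lsError
    rw [lsCount_of_lt_two hn one_pos]
    rcases hx0.eq_or_lt with rfl | h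
    · simp [lsCount_zero_right]
    · rw [lsCount_of_lt_two hn h, abs_le]
      constructor <;> linarith
  induction n using Nat.twoStepInduction generalizing x with
  | zero => simpa using base 0 (by norm_num) x hx0 hx1
  | one => simpa using (base 1 (by norm_num) x hx0 hx1).trans (by linarith)
  | more n ih0 ih1 =>
    have step : ∀ u v : ℝ, 0 ≤ v → v ≤ 1 → |u| ≤ 1 + L * (n + 1) →
        |u - (-1) ^ n * L * v| ≤ 1 + L * (n + 2) := by
      intro u v hv0 hv1 hu
      calc |u - (-1) ^ n * L * v| ≤ |u| + |(-1) ^ n * L * v| := abs_sub _ _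
        _ = |u| + L * v := by
          rw [abs_mul, abs_mul, abs_pow, abs_neg, abs_one, one_pow, one_mul, abs_of_nonneg hL,
            abs_of_nonneg hv0]
        _ ≤ 1 + L * (n + 2) := by nlinarith
    push_cast
    obtain ⟨y, hy0, hy1, ⟨i, hi, hx⟩ | ⟨i, hi, hx⟩⟩ := exists_cell h1 hx0 hx1
    · rw [hx, lsError_long hγ h1 n hi hy0 hy1, ← hx]
      exact step _ _ hx0 hx1 (by simpa using ih1 hy0 hy1)
    · rw [hx, lsError_short hγ h1 n hi hy0 hy1, ← hx]
      have hle : L * (1 - x) ≤ 1 := by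
        have : L * γ ≤ x := by
          rw [hx]
          have : 0 ≤ (i + y) * γ * γ := by positivity
          linarith
        have : 1 - x ≤ γ := by linarith
        nlinarith
      exact step _ _ (mul_nonneg hL (by linarith)) hle ((ih0 hy0 hy1).trans (by linarith))

lemma exists_le_lsError (hL : 1 ≤ L) (hγ : 0 < γ) (h1 : (L + 1) * γ = 1) (n : ℕ) :
    ∃ x : ℝ, 0 ≤ x ∧ x < 1 ∧ ((n : ℝ) - 1) / 8 ≤ -((-1) ^ n * lsError L γ n x) := by
  induction n using Nat.twoStepInduction with
  | zero => exact ⟨0, le_rfl, one_pos, by norm_num [lsError, lsCount_zero_right]⟩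
  | one => exact ⟨0, le_rfl, one_pos, by simp [lsError, lsCount_zero_right]⟩
  | more n ih _ =>
    obtain ⟨y, hy0, hy1, hy⟩ := ih
    have h := lsError_short hγ h1 n (Nat.succ_pos L) hy0 hy1.le
    push_cast at h
    rw [zero_add] at h
    have hL' : (1 : ℝ) ≤ L := by exact_mod_cast hL
    have hLγ : 1 / 2 ≤ L * γ := by nlinarith
    have hgain : 1 / 4 ≤ L * (L * (1 - (L + y * γ) * γ)) := by
      have h3 : L * γ * γ ≤ 1 - (L + y * γ) * γ := by
        have : y * γ * γ ≤ γ * γ := by nlinarith [mul_pos hγ hγ]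
        nlinarith
      calc (1 / 4 : ℝ) ≤ (L * γ) * (L * γ) := by nlinarith
        _ ≤ L * ((L * γ) * (L * γ)) := le_mul_of_one_le_left (by positivity) hL'
        _ = L * (L * (L * γ * γ)) := by ring
        _ ≤ _ := by gcongr
    have hsq : ((-1 : ℝ) ^ n) * (-1) ^ n = 1 := by rw [← mul_pow]; simp
    refine ⟨(L + y * γ) * γ, by positivity, ?_, ?_⟩
    · by_contra! hc
      have := mul_nonneg (zero_le_one.trans hL')
        (mul_nonneg (zero_le_one.trans hL') (sub_nonneg.2 hc))
      linarith
    · rw [h, pow_add]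
      push_cast
      linear_combination hy + hgain - L * (L * (1 - (L + y * γ) * γ)) * hsq

end Count

/-- Admissibility of digit tuples. -/
def LSAdmissible (L S n : ℕ) (i : Fin n → Fin (L + S)) : Prop :=
  ∀ h h' : Fin n, (h' : ℕ) = (h : ℕ) + 1 → ¬(L ≤ (i h : ℕ) ∧ 1 ≤ (i h' : ℕ))

lemma lsAdmissible_cons {L S n : ℕ} {d : Fin (L + S)} {i : Fin n → Fin (L + S)} :
    LSAdmissible L S (n + 1) (Fin.cons d i) ↔
      LSAdmissible L S n i ∧ ∀ h : 0 < n, ¬(L ≤ (d : ℕ) ∧ 1 ≤ (i ⟨0, h⟩ : ℕ)) := by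
  constructor
  · intro H
    refine ⟨fun h h' hh => ?_, fun hn => ?_⟩
    · simpa using H h.succ h'.succ (by simp [hh])
    · exact H 0 (Fin.succ ⟨0, hn⟩) (by simp)
  · rintro ⟨H, H0⟩ h h' hh
    cases h' using Fin.cases with
    | zero => simp at hh
    | succ h' =>
      cases h using Fin.cases with
      | zero =>
        have h0 : (h' : ℕ) = 0 := by simpa using hh
        have hn : 0 < n := by have := h'.2; omega
        have : h' = ⟨0, hn⟩ := Fin.ext h0
        subst this
        exact H0 hn
      | succ h => simpa using H h h' (by simpa using hh)

lemma mem_lamSet {L S : ℕ} {γ : ℝ} {n : ℕ} {x : ℝ} :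
    x ∈ lamSet L S γ n ↔ ∃ i : Fin n → Fin (L + S), LSAdmissible L S n i ∧
      x = ∑ k : Fin n, bcoef L γ (i k : ℕ) * γ ^ ((k : ℕ) + 1) := Iff.rfl

lemma sum_bcoef_cons (L S : ℕ) (γ : ℝ) {n : ℕ} (d : Fin (L + S)) (i : Fin n → Fin (L + S)) :
    ∑ k : Fin (n + 1), bcoef L γ ((Fin.cons d i : Fin (n + 1) → Fin (L + S)) k : ℕ) *
        γ ^ ((k : ℕ) + 1) =
      (bcoef L γ d + ∑ k : Fin n, bcoef L γ (i k : ℕ) * γ ^ ((k : ℕ) + 1)) * γ := by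
  rw [Fin.sum_univ_succ, add_mul, Finset.sum_mul]
  simp [pow_succ, mul_assoc]

lemma mem_lamSet_succ {L S : ℕ} {γ : ℝ} {n : ℕ} {x : ℝ} :
    x ∈ lamSet L S γ (n + 1) ↔ ∃ (d : Fin (L + S)) (i : Fin n → Fin (L + S)),
      (LSAdmissible L S n i ∧ ∀ h : 0 < n, ¬(L ≤ (d : ℕ) ∧ 1 ≤ (i ⟨0, h⟩ : ℕ))) ∧
      x = (bcoef L γ d + ∑ k : Fin n, bcoef L γ (i k : ℕ) * γ ^ ((k : ℕ) + 1)) * γ := by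
  rw [mem_lamSet]
  constructor
  · rintro ⟨i, hi, rfl⟩
    rw [← Fin.cons_self_tail i] at hi ⊢
    exact ⟨i 0, Fin.tail i, lsAdmissible_cons.1 hi, sum_bcoef_cons ..⟩
  · rintro ⟨d, i, h, rfl⟩
    exact ⟨Fin.cons d i, lsAdmissible_cons.2 h, (sum_bcoef_cons ..).symm⟩

lemma lamSet_zero (L S : ℕ) (γ : ℝ) : lamSet L S γ 0 = {0} := by
  ext x
  simp [mem_lamSet, LSAdmissible]

lemma bcoef_of_lt {L i : ℕ} (γ : ℝ) (h : i < L) : bcoef L γ i = i := if_pos h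

lemma bcoef_add (L i : ℕ) (γ : ℝ) : bcoef L γ (L + i) = L + i * γ := by
  simp [bcoef]

lemma lamSet_eq_lsPts {L : ℕ} (hL : 1 ≤ L) (γ : ℝ) (n : ℕ) :
    lamSet L (L + 1) γ n = lsPts L γ (n + 1) := by
  induction n using Nat.twoStepInduction with
  | zero => rw [lamSet_zero]; rfl
  | one =>
    ext x
    rw [mem_lamSet_succ, mem_lsPts_add_two]
    simp only [lsPts, LSAdmissible, Set.mem_singleton_iff]
    constructor
    · rintro ⟨d, i, -, rfl⟩
      rcases lt_or_ge (d : ℕ) L with hd | hd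
      · exact Or.inl ⟨d, hd, 0, rfl, by simp [bcoef_of_lt γ hd]⟩
      · obtain ⟨e, he⟩ := Nat.exists_eq_add_of_le hd
        exact Or.inr ⟨e, by omega, 0, rfl, by simp [he, bcoef_add]⟩
    · rintro (⟨d, hd, y, rfl, rfl⟩ | ⟨e, he, y, rfl, rfl⟩)
      · exact ⟨⟨d, by omega⟩, Fin.elim0, ⟨fun h => h.elim0, by simp⟩, by simp [bcoef_of_lt γ hd]⟩
      · exact ⟨⟨L + e, by omega⟩, Fin.elim0, ⟨fun h => h.elim0, by simp⟩, by simp [bcoef_add]⟩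
  | more n ih0 ih1 =>
    ext x
    rw [mem_lamSet_succ, mem_lsPts_add_two, ← ih0, ← ih1]
    constructor
    · rintro ⟨d, i, ⟨hi, hd0⟩, rfl⟩
      rcases lt_or_ge (d : ℕ) L with hd | hd
      · exact Or.inl ⟨d, hd, _, ⟨i, hi, rfl⟩, by rw [bcoef_of_lt γ hd]⟩
      · obtain ⟨e, he⟩ := Nat.exists_eq_add_of_le hd
        have h0 : (i 0 : ℕ) = 0 := by
          have := hd0 n.succ_pos
          change ¬(L ≤ (d : ℕ) ∧ 1 ≤ (i 0 : ℕ)) at this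
          omega
        rw [← Fin.cons_self_tail i] at hi ⊢
        refine Or.inr ⟨e, by omega, _, ⟨Fin.tail i, (lsAdmissible_cons.1 hi).1, rfl⟩, ?_⟩
        rw [sum_bcoef_cons, h0, bcoef_of_lt γ hL, he, bcoef_add]
        push_cast
        ring
    · rintro (⟨d, hd, y, ⟨i, hi, rfl⟩, rfl⟩ | ⟨e, he, y, ⟨i, hi, rfl⟩, rfl⟩)
      · exact ⟨⟨d, by omega⟩, i, ⟨hi, fun _ h => absurd h.1 (by simpa using hd)⟩,
          by rw [bcoef_of_lt γ hd]⟩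
      · refine ⟨⟨L + e, by omega⟩, Fin.cons ⟨0, by omega⟩ i, ⟨lsAdmissible_cons.2 ⟨hi, ?_⟩, ?_⟩, ?_⟩
        · intro _ h
          exact absurd h.1 (by simp; omega)
        · intro _ h
          exact absurd h.2 (by simp [show (⟨0, n.succ_pos⟩ : Fin (n + 1)) = 0 from rfl])
        · rw [sum_bcoef_cons, bcoef_add, bcoef_of_lt γ hL]
          push_cast
          ring

/-- The discrepancy of a finite set, multiplied by its cardinality, in terms of the local
discrepancies of initial intervals. -/
lemma ncard_mul_discSet_bounds {A : Set ℝ} (hA : A.Finite) {t : ℝ} (ht : 0 < t)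
    (hcard : (A.ncard : ℝ) = t) {B : ℝ}
    (hB : ∀ x : ℝ, 0 ≤ x → x ≤ 1 → |((A ∩ Set.Ico 0 x).ncard : ℝ) - t * x| ≤ B) :
    t * discSet A ≤ 2 * B ∧ ∀ x : ℝ, 0 ≤ x → x ≤ 1 →
      |((A ∩ Set.Ico 0 x).ncard : ℝ) - t * x| ≤ t * discSet A := by
  have hB0 : 0 ≤ B := (abs_nonneg _).trans (hB 0 le_rfl zero_le_one)
  have hmem : ∀ d ∈ {d : ℝ | ∃ a b : ℝ, 0 ≤ a ∧ a < b ∧ b ≤ 1 ∧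
      d = |((A ∩ Set.Ico a b).ncard : ℝ) / (A.ncard : ℝ) - (b - a)|}, d ≤ 2 * B / t := by
    rintro d ⟨a, b, ha, hab, hb, rfl⟩
    have hadd : ((A ∩ Set.Ico 0 b).ncard : ℝ) =
        (A ∩ Set.Ico 0 a).ncard + (A ∩ Set.Ico a b).ncard := by
      exact_mod_cast ncard_inter_Ico_add hA ha hab.le
    rw [le_div_iff₀ ht, ← abs_of_pos ht, ← abs_mul, hcard, sub_mul,
      div_mul_cancel₀ _ ht.ne']
    have h1 := abs_le.1 (hB a ha (by linarith))
    have h2 := abs_le.1 (hB b (by linarith) hb)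
    rw [abs_le]
    constructor <;> linarith [h1.1, h1.2, h2.1, h2.2]
  have hbdd : BddAbove {d : ℝ | ∃ a b : ℝ, 0 ≤ a ∧ a < b ∧ b ≤ 1 ∧
      d = |((A ∩ Set.Ico a b).ncard : ℝ) / (A.ncard : ℝ) - (b - a)|} := ⟨_, hmem⟩
  constructor
  · have : discSet A ≤ 2 * B / t := Real.sSup_le hmem (by positivity)
    rwa [le_div_iff₀ ht, mul_comm] at this
  · intro x hx0 hx1
    rcases hx0.eq_or_lt with rfl | hx
    · have : 0 ≤ discSet A := Real.sSup_nonneg (by rintro d ⟨a, b, -, -, -, rfl⟩; positivity)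
      simpa using mul_nonneg ht.le this
    · have : |((A ∩ Set.Ico 0 x).ncard : ℝ) / (A.ncard : ℝ) - (x - 0)| ≤ discSet A :=
        le_csSup hbdd ⟨0, x, le_rfl, hx, hx1, rfl⟩
      rw [hcard, sub_zero] at this
      calc |((A ∩ Set.Ico 0 x).ncard : ℝ) - t * x|
          = t * |((A ∩ Set.Ico 0 x).ncard : ℝ) / t - x| := by
            rw [← abs_of_pos ht, ← abs_mul, abs_of_pos ht, mul_sub, mul_div_cancel₀ _ ht.ne']
        _ ≤ _ := by gcongr

lemma lsCount_one_eq_ncard {L : ℕ} {γ : ℝ} (hγ : 0 < γ) (h1 : (L + 1) * γ = 1) (n : ℕ) :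
    lsCount L γ n 1 = (lsPts L γ n).ncard := by
  rw [lsCount, Set.inter_eq_left.2 (lsPts_subset_Ico hγ h1 n)]

lemma two_pow_le_and_le_pow {L : ℕ} (hL : 1 ≤ L) {t : ℕ → ℕ} (ht0 : t 0 = 1)
    (ht1 : t 1 = L + (L + 1)) (htrec : ∀ n : ℕ, t (n + 2) = L * t (n + 1) + (L + 1) * t n) (n : ℕ) :
    2 ^ n ≤ t n ∧ t n ≤ (2 * (L + 1)) ^ n := by
  induction n using Nat.twoStepInduction with
  | zero => simp [ht0]
  | one => rw [ht1, pow_one, pow_one]; constructor <;> omega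
  | more n ih0 ih1 =>
    obtain ⟨ih0, ih0'⟩ := ih0
    obtain ⟨ih1, ih1'⟩ := ih1
    rw [htrec]
    constructor
    · calc 2 ^ (n + 2) = 1 * 2 ^ (n + 1) + (1 + 1) * 2 ^ n := by ring
        _ ≤ L * t (n + 1) + (L + 1) * t n := by gcongr
    · calc L * t (n + 1) + (L + 1) * t n
          ≤ L * (2 * (L + 1)) ^ (n + 1) + (L + 1) * (2 * (L + 1)) ^ n := by gcongr
        _ = (L * (2 * (L + 1)) + (L + 1)) * (2 * (L + 1)) ^ n := by ring
        _ ≤ (2 * (L + 1)) ^ 2 * (2 * (L + 1)) ^ n := by gcongr; nlinarith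
        _ = _ := by ring

/-- **Statement 10.** If `S = L+1`, there exist constants `c, c´ > 0` such that for every
`n ≥ 1` (here `n+1`), `c'·log tₙ ≤ tₙ · D(Λⁿ_{L,S}) ≤ c·log tₙ`. -/
theorem stmt_11 (L S : ℕ) (hL : 1 ≤ L) (hLS : 2 ≤ L + S) (hSL : S = L + 1)
    (γ : ℝ) (hγ0 : 0 < γ) (hγ1 : γ < 1)
    (hγeq : (L : ℝ) * γ + (S : ℝ) * γ ^ 2 = 1)
    (t : ℕ → ℕ) (ht0 : t 0 = 1) (ht1 : t 1 = L + S)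
    (htrec : ∀ n : ℕ, t (n + 2) = L * t (n + 1) + S * t n) :
    ∃ c > (0 : ℝ), ∃ c' > (0 : ℝ), ∀ n : ℕ,
      c' * Real.log (t (n + 1) : ℝ) ≤ (t (n + 1) : ℝ) * discSet (lamSet L S γ (n + 1)) ∧
      (t (n + 1) : ℝ) * discSet (lamSet L S γ (n + 1)) ≤ c * Real.log (t (n + 1) : ℝ) := by
  subst hSL
  have h1 : (L + 1) * γ = 1 := by
    push_cast at hγeq
    have : ((L + 1) * γ - 1) * (γ + 1) = 0 := by linear_combination hγeq
    rcases mul_eq_zero.1 this with h | h <;> linarith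
  have hL' : (1 : ℝ) ≤ L := by exact_mod_cast hL
  have hcount : ∀ n, lsCount L γ (n + 1) 1 = t n := by
    intro n
    induction n using Nat.twoStepInduction with
    | zero => simp [lsCount_of_lt_two, ht0]
    | one => simp [lsCount_one_add_two hγ0 h1 0, lsCount_of_lt_two, ht1]
    | more n ih0 ih1 =>
      rw [lsCount_one_add_two hγ0 h1 (n + 1), ih0, ih1, htrec]
      push_cast
      ring
  have hlog2 : 0 < Real.log 2 := Real.log_pos one_lt_two
  have hlogm : 0 < Real.log (2 * (L + 1)) := Real.log_pos (by linarith)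
  refine ⟨6 * L / Real.log 2, by positivity, 1 / (8 * Real.log (2 * (L + 1))), by positivity,
    fun n => ?_⟩
  obtain ⟨htl, htu⟩ := two_pow_le_and_le_pow hL ht0 ht1 htrec (n + 1)
  have hpos : (0 : ℝ) < t (n + 1) := by
    exact_mod_cast (pow_pos two_pos (n + 1)).trans_le htl
  have hlogl : (n + 1) * Real.log 2 ≤ Real.log (t (n + 1)) := by
    have := Real.log_le_log (by positivity) (by exact_mod_cast htl : (2 : ℝ) ^ (n + 1) ≤ t (n + 1))
    rw [Real.log_pow] at this
    exact_mod_cast this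
  have hlogu : Real.log (t (n + 1)) ≤ (n + 1) * Real.log (2 * (L + 1)) := by
    have := Real.log_le_log hpos
      (by exact_mod_cast htu : (t (n + 1) : ℝ) ≤ (2 * ((L : ℝ) + 1)) ^ (n + 1))
    rw [Real.log_pow] at this
    exact_mod_cast this
  rw [lamSet_eq_lsPts hL]
  have herr : ∀ x, lsError L γ (n + 2) x =
      ((lsPts L γ (n + 2) ∩ Set.Ico 0 x).ncard : ℝ) - t (n + 1) * x := by
    intro x
    rw [lsError, hcount, lsCount]
  obtain ⟨hup, hlow⟩ := ncard_mul_discSet_bounds (lsPts_finite L γ (n + 2)) hpos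
    (by rw [← hcount, lsCount_one_eq_ncard hγ0 h1])
    (fun x hx0 hx1 => herr x ▸ abs_lsError_le hγ0 h1 (n + 2) hx0 hx1)
  constructor
  · obtain ⟨x, hx0, hx1, hx⟩ := exists_le_lsError hL hγ0 h1 (n + 2)
    have habs : -((-1) ^ (n + 2) * lsError L γ (n + 2) x) ≤ |lsError L γ (n + 2) x| := by
      refine (neg_le_abs _).trans_eq ?_
      rw [abs_mul, abs_pow, abs_neg, abs_one, one_pow, one_mul]
    have hD := hlow x hx0 hx1.le
    rw [← herr] at hD
    push_cast at hx
    calc 1 / (8 * Real.log (2 * (L + 1))) * Real.log (t (n + 1))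
        ≤ 1 / (8 * Real.log (2 * (L + 1))) * ((n + 1) * Real.log (2 * (L + 1))) := by gcongr
      _ = (n + 1) / 8 := by field_simp
      _ ≤ _ := by linarith
  · calc _ ≤ 2 * (1 + L * ((n + 2 : ℕ) : ℝ)) := hup
      _ ≤ 6 * L * (n + 1) := by
        push_cast
        nlinarith [(Nat.cast_nonneg n : (0 : ℝ) ≤ n)]
      _ = 6 * L / Real.log 2 * ((n + 1) * Real.log 2) := by field_simp
      _ ≤ _ := by gcongr
end
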